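/- In the random clustering setup for k-graph systems, with probability at least 99/100 the following holds: for every S ⊆ V(H) of size at most s and every T ⊆ [tn] of size at most t, there are at least (1 − 1/C²)·m' indices i ∈ [2, m'] for which δ_d(H_i^{S⊎T}) ≥ (δ + α/2)·binom(|V_i ∪ S| − d, k − d). -/

import Mathlib

/-- Index of the interval containing `x` (1-based): `P_1 = [0, r)`, and for `i ≥ 2`,
`P_i = [r + w(i-2), r + w(i-1))`. -/
def clusterIndex (r w x : ℕ) : ℕ := if x < r then 1 else (x - r) / w + 2

open Classical in
/-- Uniform probability, over a pair of independent uniformly random permutations,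
of the event `E`. -/
noncomputable def permProb (N M : ℕ)
    (E : Equiv.Perm (Fin N) × Equiv.Perm (Fin M) → Prop) : ℝ :=
  (((Finset.univ : Finset (Equiv.Perm (Fin N) × Equiv.Perm (Fin M))).filter E).card : ℝ) /
    ((Finset.univ : Finset (Equiv.Perm (Fin N) × Equiv.Perm (Fin M))).card : ℝ)

/-- The `i`-th random cluster of `Fin (a*n)` induced by the permutation `π`:
the set of `v` with `π v` lying in the `i`-th interval, where the first interval has length
`aC(C-1)` plus the remainder of `a*n` modulo `aC(C-1)` and later intervals have
length `a(C-1)`. -/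
def partCluster (a n C i : ℕ) (π : Equiv.Perm (Fin (a * n))) : Finset (Fin (a * n)) :=
  Finset.univ.filter fun v =>
    clusterIndex (a * C * (C - 1) + (a * n) % (a * C * (C - 1))) (a * (C - 1)) (π v).val = i

/-- The number `m'` of clusters. -/
def numClusters (a n C : ℕ) : ℕ :=
  (a * n - (a * C * (C - 1) + (a * n) % (a * C * (C - 1)))) / (a * (C - 1)) + 1

/-- The sub-system `{(Hs j)[A] : j ∈ Cs}` has minimum `d`-degree at least
`(δ + α/2) * (b choose (k-d))`. -/
def SubSystemMinDeg (k s t n d : ℕ) (δ α : ℝ)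
    (Hs : Fin (t * n) → Finset (Finset (Fin (s * n))))
    (A : Finset (Fin (s * n))) (Cs : Finset (Fin (t * n))) (b : ℕ) : Prop :=
  ∀ j ∈ Cs, ∀ D : Finset (Fin (s * n)), D ⊆ A → D.card = d →
    (δ + α / 2) * ((b.choose (k - d)) : ℝ) ≤
      (((Hs j).filter fun e => D ⊆ e ∧ e ⊆ A).card : ℝ)

theorem exp_neg_le_quadratic {x : ℝ} (hx : 0 ≤ x) : Real.exp (-x) ≤ 1 - x + x ^ 2 / 2 := by
  have h1 := Real.quadratic_le_exp_of_nonneg hx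
  rw [Real.exp_neg, inv_le_comm₀ (Real.exp_pos x) (by nlinarith [sq_nonneg (x - 1)])]
  refine le_trans ?_ h1
  rw [inv_le_iff_one_le_mul₀ (by nlinarith [sq_nonneg (x - 1)])]
  nlinarith [sq_nonneg (x ^ 2)]

/-- Moment generating function bound for the number of successes in independent trials, each
succeeding on a `θ`-fraction of the finite sample space `Ω`. -/
theorem sum_exp_neg_card_le {β Ω : Type*} [Fintype β] [DecidableEq β] [Fintype Ω]
    (P : Ω → Prop) [DecidablePred P] {θ c : ℝ}
    (hθ : θ ≤ 1) (hc : 0 ≤ c)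
    (hP : θ * Fintype.card Ω ≤ ((Finset.univ.filter P).card : ℝ)) :
    ∑ f : β → Ω, Real.exp (-c * ((Finset.univ.filter fun b => P (f b)).card : ℝ)) ≤
      (Fintype.card Ω : ℝ) ^ Fintype.card β *
        Real.exp (Fintype.card β * (-θ * c + c ^ 2 / 2)) := by
  have h1 : ∀ f : β → Ω, Real.exp (-c * ((Finset.univ.filter fun b => P (f b)).card : ℝ)) =
      ∏ b, (if P (f b) then Real.exp (-c) else 1) := by
    intro f
    rw [Finset.prod_ite, Finset.prod_const, Finset.prod_const_one, mul_one, ← Real.exp_nat_mul,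
      mul_comm]
  have h2 : ∑ f : β → Ω, ∏ b, (if P (f b) then Real.exp (-c) else 1) =
      (∑ ω : Ω, if P ω then Real.exp (-c) else 1) ^ Fintype.card β := by
    have := Finset.prod_univ_sum (fun _ : β => (Finset.univ : Finset Ω))
      (fun _ ω => if P ω then Real.exp (-c) else (1 : ℝ))
    rw [Finset.prod_const, Finset.card_univ, Fintype.piFinset_univ] at this
    exact this.symm
  have h3 : ∑ ω : Ω, (if P ω then Real.exp (-c) else 1) =
      (Fintype.card Ω : ℝ) - (Finset.univ.filter P).card * (1 - Real.exp (-c)) := by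
    have : ∀ ω, (if P ω then Real.exp (-c) else 1) =
        1 - (if P ω then (1 - Real.exp (-c)) else 0) := by
      intro ω; split_ifs <;> ring
    simp_rw [this]
    rw [Finset.sum_sub_distrib, ← Finset.sum_filter, Finset.sum_const, Finset.sum_const]
    simp
  have he : Real.exp (-c) ≤ 1 := Real.exp_le_one_iff.2 (by linarith)
  have hq := exp_neg_le_quadratic hc
  rcases isEmpty_or_nonempty Ω with hΩ | hΩ
  · simp_rw [h1]
    rw [h2]
    rcases Nat.eq_zero_or_pos (Fintype.card β) with h0 | h0
    · simp [h0]
    · simp [h0.ne']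
  have hpos : (0 : ℝ) < Fintype.card Ω := by exact_mod_cast Fintype.card_pos
  simp_rw [h1]
  rw [h2, Real.exp_nat_mul, ← mul_pow]
  refine pow_le_pow_left₀ (Finset.sum_nonneg fun ω _ => by split_ifs <;> positivity) ?_ _
  rw [h3]
  have hθ0 : 0 ≤ 1 - θ := by linarith
  have key : 1 - θ * (1 - Real.exp (-c)) ≤ Real.exp (-θ * c + c ^ 2 / 2) := by
    by_cases h0 : 0 ≤ θ
    · refine le_trans ?_ (Real.add_one_le_exp _)
      nlinarith [mul_le_mul_of_nonneg_left hq h0, mul_nonneg hθ0 (sq_nonneg c)]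
    · push Not at h0
      refine le_trans ?_ (Real.add_one_le_exp _)
      have := Real.add_one_le_exp (-c)
      nlinarith [mul_le_mul_of_nonneg_left this (neg_nonneg.2 h0.le), sq_nonneg c]
  calc (Fintype.card Ω : ℝ) - (Finset.univ.filter P).card * (1 - Real.exp (-c))
      ≤ Fintype.card Ω - θ * Fintype.card Ω * (1 - Real.exp (-c)) := by
        nlinarith [mul_le_mul_of_nonneg_right hP (sub_nonneg.2 he)]
    _ = Fintype.card Ω * (1 - θ * (1 - Real.exp (-c))) := by ring
    _ ≤ _ := by gcongr

theorem sum_comp_injective {κ ι V : Type*} [Fintype κ] [Fintype ι] [DecidableEq ι] [DecidableEq κ]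
    [Fintype V] {g : κ → ι} (hg : Function.Injective g) (φ : (κ → V) → ℝ) :
    ∑ y : ι → V, φ (fun a => y (g a)) =
      (Fintype.card V : ℝ) ^ (Fintype.card ι - Fintype.card κ) * ∑ z, φ z := by
  classical
  let e : κ ⊕ {i // i ∉ Set.range g} ≃ ι :=
    ((Equiv.ofInjective g hg).sumCongr (Equiv.refl _)).trans (Equiv.Set.sumCompl (Set.range g))
  have he : ∀ a, e (Sum.inl a) = g a := fun a => Equiv.Set.sumCompl_apply_inl _ _
  let E : (ι → V) ≃ (κ → V) × ({i // i ∉ Set.range g} → V) :=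
    (Equiv.arrowCongr e.symm (Equiv.refl V)).trans (Equiv.sumArrowEquivProdArrow _ _ _)
  have hE : ∀ y, (fun a => y (g a)) = (E y).1 := by
    intro y; funext a; simp [E, ← he, Equiv.sumArrowEquivProdArrow, Equiv.arrowCongr]
  have hcard : Fintype.card {i // i ∉ Set.range g} = Fintype.card ι - Fintype.card κ := by
    rw [← Fintype.card_congr e, Fintype.card_sum]; omega
  simp_rw [hE]
  rw [Fintype.sum_equiv E (fun y => φ (E y).1) (fun z => φ z.1) (fun _ => rfl),
    Fintype.sum_prod_type]
  simp only [Finset.sum_const, Finset.card_univ, Fintype.card_fun, hcard, nsmul_eq_mul,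
    Finset.mul_sum, Nat.cast_pow]

open Classical in
theorem card_mul_factorial_le_card_image_mem {V : Type*} [Fintype V] [DecidableEq V] {l : ℕ}
    {F : Finset (Finset V)} (hF : ∀ e ∈ F, e.card = l) :
    F.card * l.factorial ≤
      (Finset.univ.filter fun z : Fin l → V => Finset.univ.image z ∈ F).card := by
  have h : (F.sum fun e => (Finset.univ.filter fun z : Fin l → V => Finset.univ.image z = e).card) =
      (Finset.univ.filter fun z : Fin l → V => Finset.univ.image z ∈ F).card := by
    rw [Finset.card_eq_sum_card_fiberwise (f := fun z : Fin l → V => Finset.univ.image z) (t := F)]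
    · refine Finset.sum_congr rfl fun e he => ?_
      congr 1
      ext z
      simp only [Finset.mem_filter, Finset.mem_univ, true_and]
      exact ⟨fun h => ⟨h ▸ he, h⟩, fun h => h.2⟩
    · intro z hz
      simpa using hz
  rw [← h, ← smul_eq_mul, ← Finset.sum_const]
  refine Finset.sum_le_sum fun e he => ?_
  have hc : Fintype.card (Fin l ≃ e) = l.factorial := by
    rw [Fintype.card_equiv (Fintype.equivOfCardEq (by simp [hF e he]))]; simp
  rw [← hc, ← Finset.card_univ]
  refine Finset.card_le_card_of_injOn (fun f a => (f a : V)) ?_ ?_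
  · intro f _
    simp only [Finset.coe_filter, Finset.mem_univ, true_and, Set.mem_ofPred_eq]
    ext v
    simp only [Finset.mem_image, Finset.mem_univ, true_and]
    exact ⟨fun ⟨a, ha⟩ => ha ▸ (f a).2, fun hv => ⟨f.symm ⟨v, hv⟩, by simp⟩⟩
  · intro f _ f' _ hff
    ext a
    exact congrFun hff a

open Classical in
theorem card_perm_image_mem {ι : Type*} [Fintype ι] {l : ℕ} {G : Finset (Finset ι)}
    (hG : ∀ B ∈ G, B.card = l) {B₀ : Finset ι} (hB₀ : B₀.card = l) :
    (Finset.univ.filter fun σ : Equiv.Perm ι => B₀.image σ ∈ G).card * (Fintype.card ι).choose l =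
      G.card * (Fintype.card ι).factorial := by
  set K := (Finset.univ.filter fun σ : Equiv.Perm ι => B₀.image σ = B₀).card with hK
  have h1 : ∀ B : Finset ι, B.card = l →
      (Finset.univ.filter fun σ : Equiv.Perm ι => B₀.image σ = B).card = K := by
    intro B hB
    obtain ⟨τ, hτ⟩ : ∃ τ : Equiv.Perm ι, B₀.image τ = B := by
      let e : {x // x ∈ B₀} ≃ {x // x ∈ B} := Fintype.equivOfCardEq (by simp [hB, hB₀])
      refine ⟨e.extendSubtype, ?_⟩
      refine Finset.eq_of_subset_of_card_le ?_ ?_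
      · intro v hv
        obtain ⟨a, ha, rfl⟩ := Finset.mem_image.1 hv
        rw [Equiv.extendSubtype_apply_of_mem e a ha]
        exact (e ⟨a, ha⟩).2
      · rw [Finset.card_image_of_injective _ (Equiv.injective _), hB, hB₀]
    refine Finset.card_bij' (fun σ _ => τ⁻¹ * σ) (fun σ _ => τ * σ) ?_ ?_ ?_ ?_
    · intro σ hσ
      simp only [Finset.mem_filter, Finset.mem_univ, true_and] at hσ ⊢
      rw [Equiv.Perm.coe_mul, ← Finset.image_image, hσ, ← hτ, Finset.image_image,
        ← Equiv.Perm.coe_mul]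
      simp
    · intro σ hσ
      simp only [Finset.mem_filter, Finset.mem_univ, true_and] at hσ ⊢
      rw [Equiv.Perm.coe_mul, ← Finset.image_image, hσ, hτ]
    · intro σ _; simp
    · intro σ _; simp
  have h2 : ∀ G : Finset (Finset ι), (∀ B ∈ G, B.card = l) →
      (Finset.univ.filter fun σ : Equiv.Perm ι => B₀.image σ ∈ G).card = G.card * K := by
    intro G hG
    rw [Finset.card_eq_sum_card_fiberwise (f := fun σ : Equiv.Perm ι => B₀.image σ) (t := G),
      ← smul_eq_mul, ← Finset.sum_const]
    · refine Finset.sum_congr rfl fun e he => ?_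
      rw [← h1 e (hG e he)]
      congr 1
      ext z
      simp only [Finset.mem_filter, Finset.mem_univ, true_and]
      exact ⟨fun h => h.2, fun h => ⟨h ▸ he, h⟩⟩
    · intro z hz
      simpa using hz
  have h3 := h2 (Finset.univ.powersetCard l) (fun B hB => (Finset.mem_powersetCard.1 hB).2)
  rw [Finset.card_powersetCard, Finset.card_univ, Finset.filter_true_of_mem, Finset.card_univ,
    Fintype.card_perm] at h3
  · rw [h2 G hG, h3]; ring
  · intro σ _
    rw [Finset.mem_powersetCard, Finset.card_image_of_injective _ σ.injective]
    exact ⟨Finset.subset_univ _, hB₀⟩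

open Classical in
/-- Double counting of the blocks of a permuted block decomposition that fall into `G`. -/
theorem sum_card_blocks_mem {ι : Type*} [Fintype ι] {l m : ℕ} {G : Finset (Finset ι)}
    (hG : ∀ B ∈ G, B.card = l) (e : Fin m × Fin l ↪ ι) :
    (∑ σ : Equiv.Perm ι, (Finset.univ.filter fun b : Fin m =>
      (Finset.univ.image fun c => σ (e (b, c))) ∈ G).card) * (Fintype.card ι).choose l =
      m * G.card * (Fintype.card ι).factorial := by
  have hB : ∀ b : Fin m, (Finset.univ.image fun c => e (b, c)).card = l := by
    intro b
    rw [Finset.card_image_of_injective]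
    · simp
    · intro c c' h
      simpa using e.injective h
  have h1 : ∑ σ : Equiv.Perm ι, (Finset.univ.filter fun b : Fin m =>
      (Finset.univ.image fun c => σ (e (b, c))) ∈ G).card =
      ∑ b : Fin m, (Finset.univ.filter fun σ : Equiv.Perm ι =>
        (Finset.univ.image fun c => e (b, c)).image σ ∈ G).card := by
    have := Finset.sum_card_bipartiteAbove_eq_sum_card_bipartiteBelow
      (s := (Finset.univ : Finset (Equiv.Perm ι))) (t := (Finset.univ : Finset (Fin m)))
      (fun σ b => (Finset.univ.image fun c => σ (e (b, c))) ∈ G)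
    refine this.trans (Finset.sum_congr rfl fun b _ => ?_)
    congr 1
    ext σ
    simp only [Finset.bipartiteBelow, Finset.mem_filter, Finset.mem_univ, true_and]
    rw [Finset.image_image]
    rfl
  rw [h1, Finset.sum_mul, Finset.sum_congr rfl fun b _ => card_perm_image_mem hG (hB b)]
  simp [mul_assoc]

open Classical in
theorem sum_exp_neg_card_blocks_le {ι V : Type*} [Fintype ι] [Fintype V] [DecidableEq V] {l m : ℕ}
    {F : Finset (Finset V)} (hF : ∀ e ∈ F, e.card = l) {θ η : ℝ} (hη : 0 ≤ η)
    (hθF : θ * (Fintype.card V : ℝ) ^ l ≤ F.card * l.factorial) (e : Fin m × Fin l ↪ ι) :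
    ∑ y : ι → V, Real.exp (-η * ((Finset.univ.filter fun b : Fin m =>
      (Finset.univ.image fun c => y (e (b, c))) ∈ F).card : ℝ)) ≤
      (Fintype.card V : ℝ) ^ Fintype.card ι * Real.exp (m * (-θ * η + η ^ 2 / 2)) := by
  rcases eq_or_ne m 0 with hm0 | hm0
  · subst hm0
    simp
  rcases isEmpty_or_nonempty (ι → V) with hemp | hne
  · simp only [Finset.univ_eq_empty, Finset.sum_empty]
    positivity
  have hm : m * l ≤ Fintype.card ι := by simpa using Fintype.card_le_of_embedding e
  have hcntR : θ * (Fintype.card (Fin l → V) : ℝ) ≤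
      ((Finset.univ.filter fun z : Fin l → V => Finset.univ.image z ∈ F).card : ℝ) := by
    have hcnt := card_mul_factorial_le_card_image_mem hF
    refine le_trans ?_ (Nat.cast_le.2 hcnt)
    simpa using hθF
  have hθ1 : θ ≤ 1 := by
    have h1 : ((Finset.univ.filter fun z : Fin l → V => Finset.univ.image z ∈ F).card : ℝ) ≤
        Fintype.card (Fin l → V) := by
      exact_mod_cast Finset.card_le_univ _
    have h2 : (0 : ℝ) < Fintype.card (Fin l → V) := by
      have : Nonempty (Fin l → V) := by
        obtain ⟨y⟩ := hne
        exact ⟨fun c => y (e (⟨0, by omega⟩, c))⟩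
      exact_mod_cast Fintype.card_pos
    by_contra! hlt
    nlinarith
  have h1 := sum_comp_injective (V := V) e.injective
    (fun z => Real.exp (-η * ((Finset.univ.filter fun b : Fin m =>
      (Finset.univ.image fun c => z (b, c)) ∈ F).card : ℝ)))
  have h2 := sum_exp_neg_card_le (β := Fin m)
    (fun z : Fin l → V => Finset.univ.image z ∈ F) hθ1 hη hcntR
  have h3 := Fintype.sum_equiv (Equiv.curry (Fin m) (Fin l) V)
    (fun z => Real.exp (-η * ((Finset.univ.filter fun b : Fin m =>
      (Finset.univ.image fun c => z (b, c)) ∈ F).card : ℝ)))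
    (fun f => Real.exp (-η * ((Finset.univ.filter fun b : Fin m =>
      Finset.univ.image (f b) ∈ F).card : ℝ))) (fun _ => rfl)
  refine h1.le.trans ?_
  rw [h3]
  refine (mul_le_mul_of_nonneg_left h2 (by positivity)).trans (le_of_eq ?_)
  simp only [Fintype.card_prod, Fintype.card_fin, Fintype.card_fun, Nat.cast_pow]
  rw [← pow_mul, ← mul_assoc, ← pow_add, mul_comm l m, Nat.sub_add_cancel hm]

open Classical in
/-- If a uniform family `F` has density at least `θ`, then a random tuple indexed by `ι` induces
density at least `θ - η` with exponentially high probability. -/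
theorem card_sparse_tuples_le {ι V : Type*} [Fintype ι] [Fintype V] [DecidableEq V] {l m : ℕ}
    {F : Finset (Finset V)} (hF : ∀ e ∈ F, e.card = l) {θ η : ℝ} (hη : 0 ≤ η)
    (hθF : θ * (Fintype.card V : ℝ) ^ l ≤ F.card * l.factorial)
    (hm : m * l ≤ Fintype.card ι) :
    ((Finset.univ.filter fun y : ι → V =>
      ((((Finset.univ : Finset ι).powersetCard l).filter fun B => B.image y ∈ F).card : ℝ) <
        (θ - η) * (Fintype.card ι).choose l).card : ℝ) ≤
      Real.exp (-(m * η ^ 2 / 2)) * (Fintype.card V : ℝ) ^ Fintype.card ι := by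
  set u := Fintype.card ι with hu
  let G : (ι → V) → Finset (Finset ι) := fun y =>
    ((Finset.univ : Finset ι).powersetCard l).filter fun B => B.image y ∈ F
  set bad := (Finset.univ.filter fun y : ι → V => ((G y).card : ℝ) < (θ - η) * u.choose l)
    with hbad
  change (bad.card : ℝ) ≤ _
  rcases Nat.eq_zero_or_pos (u.choose l) with hch | hch
  · have : bad = ∅ := by
      rw [hbad, Finset.filter_eq_empty_iff]
      intro y _
      simp [hch]
    rw [this]
    simp only [Finset.card_empty, Nat.cast_zero]
    positivity
  have hchR : (0 : ℝ) < u.choose l := by exact_mod_cast hch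
  obtain ⟨e⟩ : Nonempty (Fin m × Fin l ↪ ι) :=
    Function.Embedding.nonempty_of_card_le (by simpa using hm)
  let Z : Equiv.Perm ι → (ι → V) → ℕ := fun σ y =>
    (Finset.univ.filter fun b : Fin m => (Finset.univ.image fun c => y (σ (e (b, c)))) ∈ F).card
  have hZsum : ∀ y, (∑ σ, (Z σ y : ℝ)) * u.choose l = m * (G y).card * u.factorial := by
    intro y
    have h2 := sum_card_blocks_mem (G := G y)
      (fun B hB => (Finset.mem_powersetCard.1 (Finset.mem_filter.1 hB).1).2) e
    have h3 : ∀ σ : Equiv.Perm ι, (Finset.univ.filter fun b : Fin m =>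
        (Finset.univ.image fun c => σ (e (b, c))) ∈ G y).card = Z σ y := by
      intro σ
      simp only [Z]
      congr 1
      ext b
      have hc : (Finset.univ.image fun c => σ (e (b, c))).card = l := by
        rw [Finset.card_image_of_injective]
        · simp
        · intro c c' h
          simpa using e.injective (σ.injective h)
      simp only [Finset.mem_filter, Finset.mem_univ, true_and, G, Finset.mem_powersetCard,
        Finset.subset_univ, hc, Finset.image_image]
      rfl
    simp_rw [h3] at h2
    exact_mod_cast h2
  have hfac : (0 : ℝ) < u.factorial := by exact_mod_cast u.factorial_pos
  have hjensen : ∀ y ∈ bad, Real.exp (-η * (m * (θ - η))) ≤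
      ∑ σ : Equiv.Perm ι, (1 / (u.factorial : ℝ)) * Real.exp (-η * Z σ y) := by
    intro y hy
    have h1 := convexOn_exp.map_sum_le (t := (Finset.univ : Finset (Equiv.Perm ι)))
      (w := fun _ => 1 / (u.factorial : ℝ)) (p := fun σ => -η * Z σ y)
      (fun _ _ => by positivity)
      (by simp [Finset.card_univ, Fintype.card_perm, ← hu, hfac.ne']) (fun _ _ => Set.mem_univ _)
    simp only [smul_eq_mul] at h1
    refine le_trans (Real.exp_le_exp.2 ?_) h1
    have hy' : ((G y).card : ℝ) < (θ - η) * u.choose l := (Finset.mem_filter.1 hy).2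
    have h2 : ∑ σ, 1 / (u.factorial : ℝ) * (-η * Z σ y) =
        -η * (m * (G y).card / u.choose l) := by
      rw [← Finset.mul_sum, ← Finset.mul_sum, eq_div_of_mul_eq hchR.ne' (hZsum y)]
      field_simp
    rw [h2]
    have h3 : (m : ℝ) * (G y).card / u.choose l ≤ m * (θ - η) := by
      rw [div_le_iff₀ hchR, mul_assoc]
      exact mul_le_mul_of_nonneg_left hy'.le (Nat.cast_nonneg _)
    nlinarith [mul_le_mul_of_nonneg_left h3 hη]
  have hmgf : ∀ σ : Equiv.Perm ι, ∑ y, Real.exp (-η * Z σ y) ≤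
      (Fintype.card V : ℝ) ^ u * Real.exp (m * (-θ * η + η ^ 2 / 2)) :=
    fun σ => sum_exp_neg_card_blocks_le hF hη hθF (e.trans σ.toEmbedding)
  have hmain : (bad.card : ℝ) * Real.exp (-η * (m * (θ - η))) ≤
      (Fintype.card V : ℝ) ^ u * Real.exp (m * (-θ * η + η ^ 2 / 2)) := by
    calc (bad.card : ℝ) * Real.exp (-η * (m * (θ - η)))
        = ∑ y ∈ bad, Real.exp (-η * (m * (θ - η))) := by simp
      _ ≤ ∑ y ∈ bad, ∑ σ : Equiv.Perm ι, (1 / (u.factorial : ℝ)) * Real.exp (-η * Z σ y) :=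
        Finset.sum_le_sum hjensen
      _ ≤ ∑ y, ∑ σ : Equiv.Perm ι, (1 / (u.factorial : ℝ)) * Real.exp (-η * Z σ y) :=
        Finset.sum_le_sum_of_subset_of_nonneg (Finset.subset_univ _)
          fun _ _ _ => Finset.sum_nonneg fun _ _ =>
            mul_nonneg (by positivity) (Real.exp_pos _).le
      _ = ∑ σ : Equiv.Perm ι, (1 / (u.factorial : ℝ)) * ∑ y, Real.exp (-η * Z σ y) := by
        rw [Finset.sum_comm]
        simp_rw [Finset.mul_sum]
      _ ≤ ∑ σ : Equiv.Perm ι, (1 / (u.factorial : ℝ)) *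
          ((Fintype.card V : ℝ) ^ u * Real.exp (m * (-θ * η + η ^ 2 / 2))) :=
        Finset.sum_le_sum fun σ _ => mul_le_mul_of_nonneg_left (hmgf σ) (by positivity)
      _ = _ := by
        rw [Finset.sum_const, Finset.card_univ, Fintype.card_perm, ← hu, nsmul_eq_mul,
          ← mul_assoc, mul_one_div_cancel hfac.ne', one_mul]
  rw [← le_div_iff₀ (Real.exp_pos _), mul_div_assoc, ← Real.exp_sub] at hmain
  refine hmain.trans (le_of_eq ?_)
  rw [mul_comm]
  congr 2
  ring

open Classical in
theorem card_filter_card_le {α : Type*} [Fintype α] (d : ℕ) :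
    (Finset.univ.filter fun A : Finset α => A.card ≤ d).card ≤ (Fintype.card α + 1) ^ d := by
  have hc : Fintype.card (Fin d → Option α) = (Fintype.card α + 1) ^ d := by simp
  rw [← hc, ← Finset.card_univ]
  refine Finset.card_le_card_of_surjOn
    (fun f => Finset.univ.filter fun a => ∃ i, f i = some a) ?_
  intro A hA
  have hA' : A.card ≤ d := by simpa using hA
  refine ⟨fun i => A.toList[(i : ℕ)]?, by simp, ?_⟩
  ext a
  simp only [Finset.mem_filter, Finset.mem_univ, true_and]
  rw [← Finset.mem_toList, List.mem_iff_getElem?]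
  constructor
  · rintro ⟨i, hi⟩
    exact ⟨i, hi⟩
  · rintro ⟨i, hi⟩
    have := (List.getElem?_eq_some_iff.1 hi).1
    rw [Finset.length_toList] at this
    exact ⟨⟨i, by omega⟩, hi⟩

open Classical in
/-- For prescribed positions `A` and a prescribed set `D'`, few injective tuples `x` give the set
`x(A) ∪ D'` a small degree into `x([w]) ∪ S`. -/
theorem card_low_degree_tuples_le {V : Type*} [Fintype V] [DecidableEq V] {w k d m : ℕ}
    {H : Finset (Finset V)}
    (hH : ∀ e ∈ H, e.card = k) {θ η : ℝ} (hη : 0 ≤ η)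
    (hdeg : ∀ D : Finset V, D.card = d → θ * (Fintype.card V : ℝ) ^ (k - d) ≤
      ((H.filter fun e => D ⊆ e).card : ℝ) * (k - d).factorial)
    (A : Finset (Fin w)) {D' S : Finset V} (hD' : D' ⊆ S) (hm : m * (k - d) ≤ w - A.card) :
    ((Finset.univ.filter fun x : Fin w → V => Function.Injective x ∧ (A.image x ∪ D').card = d ∧
      ((H.filter fun e => A.image x ∪ D' ⊆ e ∧ e ⊆ Finset.univ.image x ∪ S).card : ℝ) <
        (θ - η) * (w - A.card).choose (k - d)).card : ℝ) ≤
      Real.exp (-(m * η ^ 2 / 2)) * (Fintype.card V : ℝ) ^ w := by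
  set bad := (Finset.univ.filter fun x : Fin w → V => Function.Injective x ∧
    (A.image x ∪ D').card = d ∧
    ((H.filter fun e => A.image x ∪ D' ⊆ e ∧ e ⊆ Finset.univ.image x ∪ S).card : ℝ) <
        (θ - η) * (w - A.card).choose (k - d)) with hbad
  have hcA : Fintype.card {i // i ∉ A} = w - A.card := by
    simp [Fintype.card_subtype_compl]
  have hfib : ∀ z : {i // i ∈ A} → V,
      ((bad.filter fun x => (fun i : {i // i ∈ A} => x i) = z).card : ℝ) ≤
      Real.exp (-(m * η ^ 2 / 2)) * (Fintype.card V : ℝ) ^ (w - A.card) := by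
    intro z
    set D := Finset.univ.image z ∪ D' with hD
    have himg : ∀ x : Fin w → V, (fun i : {i // i ∈ A} => x i) = z → A.image x ∪ D' = D := by
      rintro x rfl
      rw [hD]
      congr 1
      ext v
      simp
    by_cases hDd : D.card = d
    swap
    · have : (bad.filter fun x => (fun i : {i // i ∈ A} => x i) = z) = ∅ := by
        rw [Finset.filter_eq_empty_iff]
        intro x hx hxz
        rw [← himg x hxz] at hDd
        exact hDd (Finset.mem_filter.1 hx).2.2.1
      rw [this]
      simp only [Finset.card_empty, Nat.cast_zero]
      positivity
    set F := (H.filter fun e => D ⊆ e).image (fun e => e \ D) with hFdef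
    have hF : ∀ e ∈ F, e.card = k - d := by
      intro e he
      obtain ⟨e', he', rfl⟩ := Finset.mem_image.1 he
      obtain ⟨h1, h2⟩ := Finset.mem_filter.1 he'
      rw [Finset.card_sdiff_of_subset h2, hH e' h1, hDd]
    have hFcard : F.card = (H.filter fun e => D ⊆ e).card := by
      refine Finset.card_image_of_injOn ?_
      intro e he e' he' h
      simp only [Finset.coe_filter, Set.mem_ofPred_eq] at he he'
      rw [← Finset.sdiff_union_of_subset he.2, ← Finset.sdiff_union_of_subset he'.2]
      exact congrArg (· ∪ D) h
    have hθF : θ * (Fintype.card V : ℝ) ^ (k - d) ≤ F.card * (k - d).factorial := by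
      rw [hFcard]
      exact hdeg D hDd
    have hmain := card_sparse_tuples_le (ι := {i // i ∉ A}) (m := m) hF hη hθF (by rw [hcA]; exact hm)
    rw [hcA] at hmain
    refine le_trans (Nat.cast_le.2 ?_) hmain
    refine Finset.card_le_card_of_injOn (fun x i => x i) ?_ ?_
    · intro x hx
      simp only [Finset.coe_filter, Set.mem_ofPred_eq, Finset.mem_univ, true_and] at hx ⊢
      obtain ⟨hxb, hxz⟩ := hx
      obtain ⟨-, hinj, -, hlt⟩ := Finset.mem_filter.1 hxb
      rw [himg x hxz] at hlt
      refine lt_of_le_of_lt (Nat.cast_le.2 ?_) hlt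
      refine Finset.card_le_card_of_injOn
        (fun B => B.image (fun i : {i // i ∉ A} => x i) ∪ D) ?_ ?_
      · intro B hB
        simp only [Finset.coe_filter, Set.mem_ofPred_eq, Finset.mem_powersetCard] at hB ⊢
        obtain ⟨e, he, heB⟩ := Finset.mem_image.1 hB.2
        obtain ⟨h1, h2⟩ := Finset.mem_filter.1 he
        have h3 : B.image (fun i : {i // i ∉ A} => x i) ∪ D = e := by
          rw [← heB, Finset.sdiff_union_of_subset h2]
        refine ⟨h3 ▸ h1, Finset.subset_union_right, ?_⟩
        refine Finset.union_subset ?_ ?_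
        · refine subset_trans ?_ Finset.subset_union_left
          intro v hv
          obtain ⟨i, _, rfl⟩ := Finset.mem_image.1 hv
          exact Finset.mem_image_of_mem _ (Finset.mem_univ _)
        · rw [← himg x hxz]
          exact Finset.union_subset_union (Finset.image_subset_image (Finset.subset_univ _)) hD'
      · intro B hB B' hB' h
        simp only [Finset.coe_filter, Set.mem_ofPred_eq, Finset.mem_powersetCard] at hB hB'
        have hdis : ∀ e ∈ F, Disjoint e D := by
          intro e he
          obtain ⟨e', he', rfl⟩ := Finset.mem_image.1 he
          exact Finset.sdiff_disjoint
        have h2 := congrArg (· \ D) h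
        simp only [Finset.union_sdiff_right] at h2
        rw [Finset.sdiff_eq_self_of_disjoint (hdis _ hB.2),
          Finset.sdiff_eq_self_of_disjoint (hdis _ hB'.2)] at h2
        exact Finset.image_injective (hinj.comp Subtype.val_injective) h2
    · intro x hx x' hx' h
      simp only [Finset.coe_filter, Set.mem_ofPred_eq] at hx hx'
      funext i
      by_cases hi : i ∈ A
      · exact congrFun (hx.2.trans hx'.2.symm) ⟨i, hi⟩
      · exact congrFun h ⟨i, hi⟩
  have hsum : bad.card = ∑ z : {i // i ∈ A} → V,
      (bad.filter fun x => (fun i : {i // i ∈ A} => x i) = z).card :=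
    Finset.card_eq_sum_card_fiberwise (fun _ _ => Finset.mem_coe.2 (Finset.mem_univ _))
  rw [hsum, Nat.cast_sum]
  refine (Finset.sum_le_sum fun z _ => hfib z).trans (le_of_eq ?_)
  rw [Finset.sum_const, Finset.card_univ, nsmul_eq_mul, Fintype.card_fun, Nat.cast_pow,
    Fintype.card_coe, mul_left_comm, ← pow_add, Nat.add_sub_cancel' (by simpa using A.card_le_univ)]

/-- The set `W` contains a `d`-set whose degree, within `W`, in some member `Hs j` with `j ∈ J`
is below `ψ` times the number of candidate edges. -/
def HasLowDegree {V κ : Type*} [DecidableEq V] (k d : ℕ) (ψ : ℝ) (Hs : κ → Finset (Finset V))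
    (J : Finset κ) (W : Finset V) : Prop :=
  ∃ j ∈ J, ∃ D ⊆ W, D.card = d ∧
    (((Hs j).filter fun e => D ⊆ e ∧ e ⊆ W).card : ℝ) < ψ * (W.card - d).choose (k - d)

open Classical in
theorem card_hasLowDegree_tuples_le {V κ : Type*} [Fintype V] [DecidableEq V] {w k d m : ℕ}
    {Hs : κ → Finset (Finset V)} (hH : ∀ j, ∀ e ∈ Hs j, e.card = k) {θ η ψ : ℝ} (hη : 0 ≤ η)
    (hdeg : ∀ j, ∀ D : Finset V, D.card = d → θ * (Fintype.card V : ℝ) ^ (k - d) ≤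
      (((Hs j).filter fun e => D ⊆ e).card : ℝ) * (k - d).factorial)
    (J : Finset κ) (S : Finset V) (hm : m * (k - d) ≤ w - d) (hψ : 0 ≤ ψ) (hθη : η ≤ θ)
    (hψθ : ψ * (w + S.card - d).choose (k - d) ≤ (θ - η) * (w - d).choose (k - d)) :
    ((Finset.univ.filter fun x : Fin w → V => Function.Injective x ∧
      HasLowDegree k d ψ Hs J (Finset.univ.image x ∪ S)).card : ℝ) ≤
      J.card * 2 ^ S.card * (w + 1) ^ d *
        (Real.exp (-(m * η ^ 2 / 2)) * (Fintype.card V : ℝ) ^ w) := by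
  let small := Finset.univ.filter fun A : Finset (Fin w) => A.card ≤ d
  let U : κ × Finset V × Finset (Fin w) → Finset (Fin w → V) := fun q =>
    Finset.univ.filter fun x : Fin w → V => Function.Injective x ∧ (q.2.2.image x ∪ q.2.1).card = d ∧
      (((Hs q.1).filter fun e => q.2.2.image x ∪ q.2.1 ⊆ e ∧ e ⊆ Finset.univ.image x ∪ S).card : ℝ) <
        (θ - η) * (w - q.2.2.card).choose (k - d)
  have hsub : (Finset.univ.filter fun x : Fin w → V => Function.Injective x ∧
      HasLowDegree k d ψ Hs J (Finset.univ.image x ∪ S)) ⊆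
      (J ×ˢ S.powerset ×ˢ small).biUnion U := by
    intro x hx
    obtain ⟨-, hinj, j, hj, D, hDW, hDd, hlt⟩ := Finset.mem_filter.1 hx
    have hDeq : (Finset.univ.filter fun i => x i ∈ D).image x ∪
        D.filter (fun v => v ∉ Finset.univ.image x) = D := by
      ext v
      simp only [Finset.mem_union, Finset.mem_image, Finset.mem_filter, Finset.mem_univ, true_and]
      constructor
      · rintro (⟨i, hi, rfl⟩ | h)
        · exact hi
        · exact h.1
      · intro hv
        by_cases h : ∃ i, x i = v
        · obtain ⟨i, rfl⟩ := h
          exact Or.inl ⟨i, hv, rfl⟩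
        · exact Or.inr ⟨hv, h⟩
    have hAd : (Finset.univ.filter fun i => x i ∈ D).card ≤ d := by
      rw [← hDd]
      refine Finset.card_le_card_of_injOn x (fun i hi => ?_) hinj.injOn
      simpa using hi
    rw [Finset.mem_biUnion]
    refine ⟨(j, D.filter (fun v => v ∉ Finset.univ.image x), Finset.univ.filter fun i => x i ∈ D),
      ?_, ?_⟩
    · simp only [Finset.mem_product, Finset.mem_powerset, small, Finset.mem_filter,
        Finset.mem_univ, true_and]
      refine ⟨hj, ?_, hAd⟩
      intro v hv
      rw [Finset.mem_filter] at hv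
      exact (Finset.mem_union.1 (hDW hv.1)).resolve_left hv.2
    · simp only [U, Finset.mem_filter, Finset.mem_univ, true_and]
      rw [hDeq]
      refine ⟨hinj, hDd, hlt.trans_le ?_⟩
      have hW : (Finset.univ.image x ∪ S).card ≤ w + S.card := by
        refine (Finset.card_union_le _ _).trans (Nat.add_le_add_right ?_ _)
        exact Finset.card_image_le.trans (by simp)
      calc ψ * (((Finset.univ.image x ∪ S).card - d).choose (k - d) : ℝ)
          ≤ ψ * (w + S.card - d).choose (k - d) := by
            refine mul_le_mul_of_nonneg_left ?_ hψ
            exact_mod_cast Nat.choose_le_choose _ (Nat.sub_le_sub_right hW _)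
        _ ≤ (θ - η) * (w - d).choose (k - d) := hψθ
        _ ≤ _ := by
            refine mul_le_mul_of_nonneg_left ?_ (by linarith)
            exact_mod_cast Nat.choose_le_choose _ (Nat.sub_le_sub_left hAd _)
  have hU : ∀ q ∈ J ×ˢ S.powerset ×ˢ small, ((U q).card : ℝ) ≤
      Real.exp (-(m * η ^ 2 / 2)) * (Fintype.card V : ℝ) ^ w := by
    rintro ⟨j, D', A⟩ hq
    simp only [Finset.mem_product, Finset.mem_powerset, small, Finset.mem_filter,
      Finset.mem_univ, true_and] at hq
    exact card_low_degree_tuples_le (hH j) hη (hdeg j) A hq.2.1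
      (hm.trans (Nat.sub_le_sub_left hq.2.2 _))
  have hcard : ((J ×ˢ S.powerset ×ˢ small).card : ℝ) ≤ J.card * 2 ^ S.card * (w + 1) ^ d := by
    have h1 : small.card ≤ (w + 1) ^ d := by simpa using card_filter_card_le (α := Fin w) d
    rw [Finset.card_product, Finset.card_product, Finset.card_powerset, ← mul_assoc]
    push_cast
    refine mul_le_mul_of_nonneg_left ?_ (by positivity)
    exact_mod_cast h1
  calc _ ≤ (((J ×ˢ S.powerset ×ˢ small).biUnion U).card : ℝ) :=
        Nat.cast_le.2 (Finset.card_le_card hsub)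
    _ ≤ ((∑ q ∈ J ×ˢ S.powerset ×ˢ small, (U q).card : ℕ) : ℝ) :=
        Nat.cast_le.2 Finset.card_biUnion_le
    _ = ∑ q ∈ J ×ˢ S.powerset ×ˢ small, ((U q).card : ℝ) := by push_cast; rfl
    _ ≤ _ := by
        refine (Finset.sum_le_sum hU).trans ?_
        rw [Finset.sum_const, nsmul_eq_mul]
        exact mul_le_mul_of_nonneg_right hcard (by positivity)

theorem card_perm_comp_le {N : ℕ} {κ : Type*} [Fintype κ] [DecidableEq κ] {pos : κ → Fin N}
    (hpos : Function.Injective pos) (Q : (κ → Fin N) → Prop)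
    [DecidablePred Q] :
    (Finset.univ.filter fun π : Equiv.Perm (Fin N) => Q fun a => π.symm (pos a)).card ≤
      (N - Fintype.card κ).factorial * (Finset.univ.filter Q).card := by
  classical
  refine Finset.card_le_mul_card_image_of_maps_to (f := fun π a => π.symm (pos a)) ?_ _ ?_
  · intro π hπ
    simpa using hπ
  · intro z _
    rcases Finset.eq_empty_or_nonempty ((Finset.univ.filter fun π : Equiv.Perm (Fin N) =>
      Q fun a => π.symm (pos a)).filter fun π => (fun a => π.symm (pos a)) = z) with h0 | ⟨π₀, hπ₀⟩
    · rw [h0]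
      simp
    have hz₀ : ∀ a, π₀.symm (pos a) = z a := congrFun (Finset.mem_filter.1 hπ₀).2
    have hc : Fintype.card {f : Equiv.Perm (Fin N) // ∀ a, ¬ (a ∉ Set.range pos) → f a = a} =
        (N - Fintype.card κ).factorial := by
      rw [← Fintype.card_congr (Equiv.Perm.subtypeEquivSubtypePerm (· ∉ Set.range pos)),
        Fintype.card_perm, Fintype.card_subtype_compl, Fintype.card_fin]
      congr 2
      exact (Fintype.card_congr (Equiv.ofInjective pos hpos)).symm
    rw [← hc, Fintype.card_subtype]
    refine Finset.card_le_card_of_injOn (fun π => π * π₀⁻¹) ?_ ?_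
    · intro π hπ
      simp only [Finset.coe_filter, Finset.mem_filter, Finset.mem_univ, true_and,
        Set.mem_ofPred_eq, not_not] at hπ ⊢
      rintro _ ⟨a, rfl⟩
      have := congrFun hπ.2 a
      rw [Equiv.Perm.mul_apply]
      change π (π₀.symm (pos a)) = pos a
      rw [hz₀, ← this, Equiv.apply_symm_apply]
    · intro π _ π' _ h
      exact mul_right_cancel h

theorem one_sub_mul_le_pow {x : ℝ} (hx : x ≤ 1) (n : ℕ) : 1 - n * x ≤ (1 - x) ^ n := by
  have := one_add_mul_le_pow (a := -x) (by linarith) n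
  rw [← sub_eq_add_neg] at this
  linarith

open Classical in
/-- Disjoint position blocks of a random permutation behave almost independently as long as their
total length is small compared to `N / w`. -/
theorem card_perm_forall_blocks_le {N w : ℕ} {ι : Type*} [Fintype ι] {pos : ι × Fin w → Fin N}
    (hpos : Function.Injective pos) (bad : ι → (Fin w → Fin N) → Prop) {p : ℝ} (hp : 0 ≤ p)
    (hN : 2 * (Fintype.card ι * w * w) ≤ N)
    (hbad : ∀ i, ((Finset.univ.filter (bad i)).card : ℝ) ≤ p * (N : ℝ) ^ w) :
    ((Finset.univ.filter fun π : Equiv.Perm (Fin N) =>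
      ∀ i, bad i fun a => π.symm (pos (i, a))).card : ℝ) ≤
      N.factorial * (2 * p) ^ Fintype.card ι := by
  set h := Fintype.card ι with hh
  have h1 := card_perm_comp_le hpos (fun z => ∀ i, bad i fun a => z (i, a))
  have h2 : (Finset.univ.filter fun z : ι × Fin w → Fin N => ∀ i, bad i fun a => z (i, a)).card =
      ∏ i, (Finset.univ.filter (bad i)).card := by
    rw [← Fintype.card_piFinset]
    refine Finset.card_bij (fun z _ i a => z (i, a)) ?_ ?_ ?_
    · intro z hz
      simpa using hz
    · intro z _ z' _ h
      ext ⟨i, a⟩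
      exact congrArg Fin.val (congrFun (congrFun h i) a)
    · intro f hf
      exact ⟨fun q => f q.1 q.2, by simpa using hf, rfl⟩
  rw [h2, Fintype.card_prod, Fintype.card_fin, ← hh] at h1
  have h3 : (∏ i, ((Finset.univ.filter (bad i)).card : ℝ)) ≤ (p * (N : ℝ) ^ w) ^ h := by
    have := Finset.prod_le_prod (s := (Finset.univ : Finset ι))
      (fun i _ => Nat.cast_nonneg (α := ℝ) (Finset.univ.filter (bad i)).card) (fun i _ => hbad i)
    simpa [hh] using this
  have hhw : h * w ≤ N := by
    rcases Nat.eq_zero_or_pos w with rfl | hw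
    · simp
    · nlinarith [Nat.zero_le (h * w * w), Nat.mul_le_mul_left (h * w) hw]
  have h4 : ((N - h * w).factorial : ℝ) * ((N : ℝ) ^ w) ^ h ≤ N.factorial * 2 ^ h := by
    have hd : ((N : ℝ) - h * w) ^ (h * w) ≤ N.descFactorial (h * w) := by
      have h5 := Nat.pow_sub_le_descFactorial N (h * w)
      have h6 : (N - h * w) ^ (h * w) ≤ N.descFactorial (h * w) :=
        (Nat.pow_le_pow_left (by omega) _).trans h5
      have h7 : (((N - h * w : ℕ) : ℝ)) ^ (h * w) ≤ N.descFactorial (h * w) := by exact_mod_cast h6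
      rwa [Nat.cast_sub hhw, Nat.cast_mul] at h7
    have hf : ((N - h * w).factorial : ℝ) * N.descFactorial (h * w) = N.factorial := by
      exact_mod_cast Nat.factorial_mul_descFactorial hhw
    have hw2 : (N : ℝ) ^ w ≤ 2 * ((N : ℝ) - h * w) ^ w := by
      rcases Nat.eq_zero_or_pos N with h0 | hNpos
      · subst h0
        rcases Nat.eq_zero_or_pos w with rfl | hw
        · norm_num
        · have : h = 0 := by
            have : h * w * w = 0 := by omega
            simpa [hw.ne'] using this
          simp [this, hw.ne']
      have hNR : (0 : ℝ) < N := by exact_mod_cast hNpos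
      have hhwR : (h : ℝ) * w ≤ N := by exact_mod_cast hhw
      have hNw : 2 * ((h : ℝ) * w * w) ≤ N := by exact_mod_cast hN
      have hx := one_sub_mul_le_pow (x := (h : ℝ) * w / N) (by rwa [div_le_one hNR]) w
      have hx2 : (1 : ℝ) / 2 ≤ 1 - w * (h * w / N) := by
        have : (w : ℝ) * (h * w / N) ≤ 1 / 2 := by
          rw [← mul_div_assoc, div_le_iff₀ hNR]
          linarith
        linarith
      have hx3 : ((N : ℝ) - h * w) ^ w = N ^ w * (1 - h * w / N) ^ w := by
        rw [← mul_pow]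
        congr 1
        field_simp
      rw [hx3]
      have := mul_le_mul_of_nonneg_left (hx2.trans hx) (pow_nonneg hNR.le w)
      linarith
    calc ((N - h * w).factorial : ℝ) * ((N : ℝ) ^ w) ^ h
        ≤ (N - h * w).factorial * (2 * ((N : ℝ) - h * w) ^ w) ^ h := by gcongr
      _ = (N - h * w).factorial * ((N : ℝ) - h * w) ^ (h * w) * 2 ^ h := by
        rw [mul_pow, ← pow_mul, mul_comm w h]
        ring
      _ ≤ (N - h * w).factorial * N.descFactorial (h * w) * 2 ^ h := by gcongr
      _ = _ := by rw [hf]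
  calc _ ≤ (((N - h * w).factorial * ∏ i, (Finset.univ.filter (bad i)).card : ℕ) : ℝ) :=
        Nat.cast_le.2 h1
    _ ≤ (N - h * w).factorial * (p * (N : ℝ) ^ w) ^ h := by
        push_cast
        gcongr
    _ = (N - h * w).factorial * ((N : ℝ) ^ w) ^ h * p ^ h := by
        rw [mul_pow]
        ring
    _ ≤ N.factorial * 2 ^ h * p ^ h := by gcongr
    _ = _ := by rw [mul_pow]; ring

theorem choose_le_three_mul_div_pow {M h : ℕ} {c : ℝ} (hc : (M : ℝ) ≤ c * h) :
    (M.choose h : ℝ) ≤ (3 * c) ^ h := by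
  rcases Nat.eq_zero_or_pos h with rfl | hh
  · simp
  have hhR : (0 : ℝ) < h := by exact_mod_cast hh
  have hc0 : 0 ≤ c := by
    by_contra! hneg
    have : (0 : ℝ) ≤ M := Nat.cast_nonneg _
    nlinarith
  have hfac : (0 : ℝ) < h.factorial := by exact_mod_cast h.factorial_pos
  have h1 : (h : ℝ) ^ h / h.factorial ≤ 3 ^ h := by
    refine (Real.pow_div_factorial_le_exp (h : ℝ) hhR.le h).trans ?_
    rw [← mul_one (h : ℝ), Real.exp_nat_mul]
    exact pow_le_pow_left₀ (Real.exp_pos _).le Real.exp_one_lt_three.le _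
  calc (M.choose h : ℝ) ≤ (M : ℝ) ^ h / h.factorial := Nat.choose_le_pow_div h M
    _ ≤ (c * h) ^ h / h.factorial := by gcongr
    _ = c ^ h * ((h : ℝ) ^ h / h.factorial) := by rw [mul_pow]; ring
    _ ≤ c ^ h * 3 ^ h := by gcongr
    _ = _ := by rw [mul_pow]; ring

open Classical in
theorem card_le_card_filter_le {Ω : Type*} [Fintype Ω] (L : Finset ℕ) (E : ℕ → Ω → Prop) {h : ℕ}
    {b : ℝ} (hb : ∀ I ⊆ L, I.card = h →
      ((Finset.univ.filter fun ω => ∀ i ∈ I, E i ω).card : ℝ) ≤ b) :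
    ((Finset.univ.filter fun ω => h ≤ (L.filter fun i => E i ω).card).card : ℝ) ≤
      L.card.choose h * b := by
  have hsub : (Finset.univ.filter fun ω => h ≤ (L.filter fun i => E i ω).card) ⊆
      (L.powersetCard h).biUnion fun I => Finset.univ.filter fun ω => ∀ i ∈ I, E i ω := by
    intro ω hω
    obtain ⟨I, hI, hIc⟩ := Finset.exists_subset_card_eq (Finset.mem_filter.1 hω).2
    rw [Finset.mem_biUnion]
    refine ⟨I, Finset.mem_powersetCard.2 ⟨hI.trans (Finset.filter_subset _ _), hIc⟩, ?_⟩
    rw [Finset.mem_filter]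
    exact ⟨Finset.mem_univ _, fun i hi => (Finset.mem_filter.1 (hI hi)).2⟩
  calc _ ≤ ((∑ I ∈ L.powersetCard h,
        (Finset.univ.filter fun ω => ∀ i ∈ I, E i ω).card : ℕ) : ℝ) :=
        Nat.cast_le.2 ((Finset.card_le_card hsub).trans Finset.card_biUnion_le)
    _ ≤ _ := by
      rw [Nat.cast_sum]
      refine (Finset.sum_le_sum fun I hI => hb I (Finset.mem_powersetCard.1 hI).1
        (Finset.mem_powersetCard.1 hI).2).trans ?_
      rw [Finset.sum_const, Finset.card_powersetCard, nsmul_eq_mul]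

/-- A ratio comparison that is uniform in `δ ∈ [0,1]`. -/
theorem add_mul_pow_le_add_mul_sub_pow {δ β γ x c : ℝ} {l k : ℕ} (hlk : l ≤ k) (hδ0 : 0 ≤ δ)
    (hδ : δ ≤ 1) (hγ : 0 ≤ γ) (hx : 0 < x) (hc : 0 ≤ c) (hcx : c ≤ x)
    (h : (1 + γ) * (k * c) ≤ (γ - β) * x) : (δ + β) * x ^ l ≤ (δ + γ) * (x - c) ^ l := by
  have h1 := one_sub_mul_le_pow (x := c / x) (by rwa [div_le_one hx]) l
  have h2 : (x - c) ^ l = x ^ l * (1 - c / x) ^ l := by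
    rw [← mul_pow]
    congr 1
    field_simp
  have hlk' : (l : ℝ) ≤ k := by exact_mod_cast hlk
  have h3 : δ + β ≤ (δ + γ) * (1 - l * (c / x)) := by
    have h4 : (δ + γ) * (l * (c / x)) ≤ γ - β := by
      rw [← mul_div_assoc, ← mul_div_assoc, div_le_iff₀ hx]
      refine le_trans ?_ h
      gcongr
    linarith
  calc (δ + β) * x ^ l ≤ (δ + γ) * (1 - l * (c / x)) * x ^ l := by gcongr
    _ ≤ (δ + γ) * (1 - c / x) ^ l * x ^ l := by gcongr
    _ = _ := by rw [h2]; ring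

theorem exists_forall_mul_pow_mul_pow_le (K : ℝ) (r : ℕ) {ρ ε : ℝ} (hρ0 : 0 ≤ ρ) (hρ : ρ < 1)
    (hε : 0 < ε) : ∃ C₀ : ℕ, ∀ C : ℕ, C₀ ≤ C → K * ((C : ℝ) ^ r * ρ ^ C) ≤ ε := by
  have h := (tendsto_pow_const_mul_const_pow_of_abs_lt_one r
    (by rwa [abs_of_nonneg hρ0])).const_mul K
  rw [mul_zero] at h
  obtain ⟨C₀, hC₀⟩ := Filter.eventually_atTop.1 (h.eventually (gt_mem_nhds hε))
  exact ⟨C₀, fun C hC => (hC₀ C hC).le⟩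

theorem exists_forall_cluster_error_le {α : ℝ} (hα : 0 < α) {k s : ℕ} (t : ℕ) (hk : 0 < k)
    (hs : 0 < s) : ∃ C₀ : ℕ, ∀ C : ℕ, C₀ ≤ C → ∀ d m : ℕ, d ≤ k → s * C ≤ k * m + k + s + k →
      ((t * C : ℕ) : ℝ) * 2 ^ s * (((s * (C - 1) : ℕ) : ℝ) + 1) ^ d *
        Real.exp (-(m * (α / 8) ^ 2 / 2)) ≤ 1 / (24 * (C : ℝ) ^ 2) := by
  set b := (α / 8) ^ 2 / 2 with hb
  have hbpos : 0 < b := by positivity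
  have hkR : (0 : ℝ) < k := by exact_mod_cast hk
  obtain ⟨C₀, hC₀⟩ := exists_forall_mul_pow_mul_pow_le
    (24 * t * 2 ^ s * (s : ℝ) ^ k * Real.exp ((s + 2) * b)) (k + 3)
    (Real.exp_pos (-(b / k))).le (Real.exp_lt_one_iff.2 (neg_lt_zero.2 (by positivity))) one_pos
  refine ⟨max C₀ 1, fun C hC d m hd hm => ?_⟩
  have hC1 : 1 ≤ C := (le_max_right _ _).trans hC
  have hCR : (1 : ℝ) ≤ C := by exact_mod_cast hC1
  have hsR : (1 : ℝ) ≤ s := by exact_mod_cast hs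
  have key := hC₀ C ((le_max_left _ _).trans hC)
  have hmR : (s : ℝ) * C ≤ k * m + k + s + k := by exact_mod_cast hm
  have hexp : Real.exp (-(m * (α / 8) ^ 2 / 2)) ≤
      Real.exp ((s + 2) * b) * Real.exp (-(b / k)) ^ C := by
    rw [← Real.exp_nat_mul, ← Real.exp_add, Real.exp_le_exp]
    have h1 : (C : ℝ) / k ≤ m + s + 2 := by
      rw [div_le_iff₀ hkR]
      have hk1 : (1 : ℝ) ≤ k := by exact_mod_cast hk
      nlinarith
    have h2 := mul_le_mul_of_nonneg_right h1 hbpos.le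
    have h3 : (C : ℝ) * -(b / k) = -(C / k * b) := by ring
    rw [h3, mul_div_assoc, ← hb]
    linarith
  have hw : ((s * (C - 1) : ℕ) : ℝ) + 1 ≤ s * C := by
    rw [Nat.cast_mul, Nat.cast_sub hC1]
    push_cast
    nlinarith
  have hwd : (((s * (C - 1) : ℕ) : ℝ) + 1) ^ d ≤ (s : ℝ) ^ k * (C : ℝ) ^ k := by
    rw [← mul_pow]
    calc (((s * (C - 1) : ℕ) : ℝ) + 1) ^ d ≤ ((s : ℝ) * C) ^ d := by gcongr
      _ ≤ _ := pow_le_pow_right₀ (by nlinarith) hd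
  rw [le_div_iff₀ (by positivity)]
  calc _ ≤ ((t * C : ℕ) : ℝ) * 2 ^ s * ((s : ℝ) ^ k * (C : ℝ) ^ k) *
        (Real.exp ((s + 2) * b) * Real.exp (-(b / k)) ^ C) * (24 * (C : ℝ) ^ 2) := by gcongr
    _ = 24 * t * 2 ^ s * (s : ℝ) ^ k * Real.exp ((s + 2) * b) *
        ((C : ℝ) ^ (k + 3) * Real.exp (-(b / k)) ^ C) := by
      push_cast
      ring
    _ ≤ 1 := key

theorem sub_pow_le_choose_mul_factorial {x : ℝ} {u l c : ℕ} (hcx : c ≤ x)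
    (hu : x - c ≤ ((u + 1 - l : ℕ) : ℝ)) : (x - c) ^ l ≤ (u.choose l : ℝ) * l.factorial := by
  have h : (u + 1 - l) ^ l ≤ u.choose l * l.factorial := by
    rw [mul_comm, ← Nat.descFactorial_eq_factorial_mul_choose]
    exact Nat.pow_sub_le_descFactorial u l
  calc (x - c) ^ l ≤ ((u + 1 - l : ℕ) : ℝ) ^ l := pow_le_pow_left₀ (by linarith) hu _
    _ ≤ _ := by exact_mod_cast h

theorem mul_choose_le_mul_choose {ψ τ : ℝ} {u v l c : ℕ} {x : ℝ} (hψ : 0 ≤ ψ) (hτ : 0 ≤ τ)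
    (hv : (v : ℝ) ≤ x) (hcx : c ≤ x) (hu : x - c ≤ ((u + 1 - l : ℕ) : ℝ))
    (h : ψ * x ^ l ≤ τ * (x - c) ^ l) : ψ * v.choose l ≤ τ * u.choose l := by
  have hfac : (0 : ℝ) < l.factorial := by exact_mod_cast l.factorial_pos
  refine le_of_mul_le_mul_right ?_ hfac
  have h1 : (v.choose l : ℝ) * l.factorial ≤ x ^ l := by
    have h3 : v.choose l * l.factorial ≤ v ^ l := by
      rw [mul_comm, ← Nat.descFactorial_eq_factorial_mul_choose]
      exact Nat.descFactorial_le_pow v l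
    calc (v.choose l : ℝ) * l.factorial ≤ (v : ℝ) ^ l := by exact_mod_cast h3
      _ ≤ x ^ l := by gcongr
  have h2 := sub_pow_le_choose_mul_factorial hcx hu
  rw [mul_assoc, mul_assoc]
  exact (mul_le_mul_of_nonneg_left h1 hψ).trans (h.trans (mul_le_mul_of_nonneg_left h2 hτ))

theorem mul_pow_le_mul_choose_mul_factorial {ψ τ x : ℝ} {u l c : ℕ} (hτ : 0 ≤ τ) (hcx : c ≤ x)
    (hu : x - c ≤ ((u + 1 - l : ℕ) : ℝ)) (h : ψ * x ^ l ≤ τ * (x - c) ^ l) :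
    ψ * x ^ l ≤ τ * u.choose l * l.factorial := by
  have h2 := sub_pow_le_choose_mul_factorial hcx hu
  rw [mul_assoc]
  exact h.trans (mul_le_mul_of_nonneg_left h2 hτ)

open Classical in
/-- A tuple of `s(C-1)` independent uniform vertices spans a low-degree set with probability at
most `1 / (24 C²)`. -/
theorem exists_forall_card_hasLowDegree_tuples_le {α : ℝ} (hα : 0 < α) {k s : ℕ} (t : ℕ)
    (hk : 0 < k) (hs : 0 < s) : ∃ C₀ N₀ : ℕ, ∀ C : ℕ, C₀ ≤ C → ∀ N : ℕ, N₀ ≤ N →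
    ∀ δ : ℝ, 0 ≤ δ → δ ≤ 1 → ∀ d : ℕ, d ≤ k - 1 → ∀ (M : ℕ) (Hs : Fin M → Finset (Finset (Fin N))),
      (∀ i, ∀ e ∈ Hs i, e.card = k) →
      (∀ i (D : Finset (Fin N)), D.card = d → (δ + α) * ((N - d).choose (k - d) : ℝ) ≤
        (((Hs i).filter fun e => D ⊆ e).card : ℝ)) →
      ∀ (J : Finset (Fin M)) (S : Finset (Fin N)), J.card ≤ t * C → S.card ≤ s →
      ((Finset.univ.filter fun x : Fin (s * (C - 1)) → Fin N => Function.Injective x ∧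
        HasLowDegree k d (δ + α / 2) Hs J (Finset.univ.image x ∪ S)).card : ℝ) ≤
        1 / (24 * (C : ℝ) ^ 2) * (N : ℝ) ^ (s * (C - 1)) := by
  obtain ⟨C₁, hC₁⟩ := exists_forall_cluster_error_le hα t hk hs
  obtain ⟨C₂, hC₂⟩ := exists_nat_ge ((1 + 3 * α / 4) * (k * (s + k)) / (α / 4))
  obtain ⟨N₁, hN₁⟩ := exists_nat_ge ((1 + α) * (k * k) / (α / 8))
  refine ⟨C₁ + C₂ + s + k + 1, N₁ + k + 1, fun C hC N hN δ hδ0 hδ1 d hd M Hs hH hdeg J S hJ hS => ?_⟩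
  obtain ⟨l, hl⟩ : ∃ l, k - d = l := ⟨_, rfl⟩
  have hdl : d + l = k := by omega
  have hlk : l ≤ k := by omega
  have hl0 : 0 < l := by omega
  have hsC : C ≤ s * C := Nat.le_mul_of_pos_left C hs
  have hsC' : s * (C - 1) + s = s * C := by
    rw [← Nat.mul_succ]
    congr 1
    omega
  set w := s * (C - 1) with hw
  set m := (w - d) / l with hm
  have hkR : (0 : ℝ) < k := by exact_mod_cast hk
  have hNpos : (0 : ℝ) < N := by exact_mod_cast (by omega : 0 < N)
  have hNk : (k : ℝ) ≤ N := by exact_mod_cast (by omega : k ≤ N)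
  have hdeg' : ∀ j, ∀ D : Finset (Fin N), D.card = d →
      (δ + 7 * α / 8) * (Fintype.card (Fin N) : ℝ) ^ (k - d) ≤
        (((Hs j).filter fun e => D ⊆ e).card : ℝ) * (k - d).factorial := by
    intro j D hD
    rw [Fintype.card_fin, hl]
    have h1 := hdeg j D hD
    rw [hl] at h1
    have h2 : (δ + 7 * α / 8) * (N : ℝ) ^ l ≤ (δ + α) * ((N : ℝ) - k) ^ l := by
      refine add_mul_pow_le_add_mul_sub_pow hlk hδ0 hδ1 hα.le hNpos hkR.le hNk ?_
      rw [div_le_iff₀ (by positivity)] at hN₁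
      have : (N₁ : ℝ) ≤ N := by exact_mod_cast (by omega : N₁ ≤ N)
      nlinarith
    refine (mul_pow_le_mul_choose_mul_factorial (u := N - d) (by positivity) hNk ?_ h2).trans ?_
    · rw [← Nat.cast_sub (by omega)]
      exact_mod_cast (by omega : N - k ≤ N - d + 1 - l)
    · gcongr
  have hψθ : (δ + α / 2) * (w + S.card - d).choose (k - d) ≤
      (δ + 7 * α / 8 - α / 8) * (w - d).choose (k - d) := by
    rw [hl]
    have hx : ((s + k : ℕ) : ℝ) ≤ ((s * C : ℕ) : ℝ) := by exact_mod_cast (by omega : s + k ≤ s * C)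
    have h2 : (δ + α / 2) * ((s * C : ℕ) : ℝ) ^ l ≤
        (δ + 3 * α / 4) * (((s * C : ℕ) : ℝ) - (s + k : ℕ)) ^ l := by
      refine add_mul_pow_le_add_mul_sub_pow hlk hδ0 hδ1 (by positivity) ?_ (by positivity) hx ?_
      · exact_mod_cast (by omega : 0 < s * C)
      · rw [div_le_iff₀ (by positivity)] at hC₂
        have : (C₂ : ℝ) ≤ (s * C : ℕ) := by exact_mod_cast (by omega : C₂ ≤ s * C)
        push_cast at this ⊢
        nlinarith
    have h3 : δ + 7 * α / 8 - α / 8 = δ + 3 * α / 4 := by ring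
    rw [h3]
    refine mul_choose_le_mul_choose (by positivity) (by positivity) ?_ hx ?_ h2
    · exact_mod_cast (by omega : w + S.card - d ≤ s * C)
    · rw [← Nat.cast_sub (by omega)]
      exact_mod_cast (by omega : s * C - (s + k) ≤ w - d + 1 - l)
  have hmain := card_hasLowDegree_tuples_le (m := m) hH (η := α / 8) (by positivity) hdeg' J S
    (by rw [hl]; exact Nat.div_mul_le_self _ _) (by positivity) (by linarith) hψθ
  have herr := hC₁ C (by omega) d m (by omega) (by
    have h1 : w - d < l * (m + 1) := by
      rw [hm]
      exact Nat.lt_mul_div_succ _ hl0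
    have h2 : l * (m + 1) ≤ k * (m + 1) := Nat.mul_le_mul_right _ hlk
    have h3 : k * (m + 1) = k * m + k := by ring
    omega)
  refine hmain.trans ?_
  rw [Fintype.card_fin, ← mul_assoc]
  refine mul_le_mul_of_nonneg_right (le_trans ?_ herr) (by positivity)
  gcongr
  norm_num

theorem clusterIndex_add {r w i b : ℕ} (hi : 2 ≤ i) (hb : b < w) :
    clusterIndex r w (r + w * (i - 2) + b) = i := by
  have h : (r + w * (i - 2) + b - r) / w = i - 2 := by
    rw [show r + w * (i - 2) + b - r = b + w * (i - 2) by omega,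
      Nat.add_mul_div_left _ _ (by omega), Nat.div_eq_of_lt hb, zero_add]
  rw [clusterIndex, if_neg (by omega), h]
  omega

theorem exists_eq_of_clusterIndex_eq {r w i x : ℕ} (hw : 0 < w) (hi : 2 ≤ i)
    (h : clusterIndex r w x = i) : ∃ b < w, x = r + w * (i - 2) + b := by
  unfold clusterIndex at h
  split_ifs at h with hx
  · omega
  · refine ⟨(x - r) % w, Nat.mod_lt _ hw, ?_⟩
    have h1 := Nat.div_add_mod (x - r) w
    have h2 : i - 2 = (x - r) / w := by omega
    rw [h2]
    omega

theorem partCluster_eq_image {a n C i : ℕ} (hw : 0 < a * (C - 1)) (hi : 2 ≤ i)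
    (π : Equiv.Perm (Fin (a * n))) {pos : Fin (a * (C - 1)) → Fin (a * n)}
    (hpos : ∀ b, (pos b).val =
      a * C * (C - 1) + (a * n) % (a * C * (C - 1)) + a * (C - 1) * (i - 2) + b.val) :
    partCluster a n C i π = Finset.univ.image fun b => π.symm (pos b) := by
  ext v
  simp only [partCluster, Finset.mem_filter, Finset.mem_univ, true_and, Finset.mem_image]
  constructor
  · intro hv
    obtain ⟨b, hb, hvb⟩ := exists_eq_of_clusterIndex_eq hw hi hv
    refine ⟨⟨b, hb⟩, ?_⟩
    rw [Equiv.symm_apply_eq]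
    exact Fin.ext ((hpos _).trans hvb.symm)
  · rintro ⟨b, rfl⟩
    rw [Equiv.apply_symm_apply, hpos]
    exact clusterIndex_add hi b.2

theorem card_partCluster_le {a n C i : ℕ} (hw : 0 < a * (C - 1)) (hi : 2 ≤ i)
    (π : Equiv.Perm (Fin (a * n))) : (partCluster a n C i π).card ≤ a * (C - 1) := by
  set r := a * C * (C - 1) + (a * n) % (a * C * (C - 1)) with hr
  have h : ((Finset.range (a * (C - 1))).image fun b => r + a * (C - 1) * (i - 2) + b).card ≤
      a * (C - 1) := Finset.card_image_le.trans (by simp)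
  refine le_trans (Finset.card_le_card_of_injOn (fun v => (π v).val) ?_ ?_) h
  · intro v hv
    obtain ⟨b, hb, hvb⟩ := exists_eq_of_clusterIndex_eq hw hi (Finset.mem_filter.1 hv).2
    exact Finset.mem_coe.2 (Finset.mem_image.2 ⟨b, Finset.mem_range.2 hb, hvb.symm⟩)
  · intro v _ v' _ hvv
    exact π.injective (Fin.ext hvv)

theorem first_add_mul_numClusters_le {a n C : ℕ} (hn : C * (C - 1) ≤ n) :
    a * C * (C - 1) + (a * n) % (a * C * (C - 1)) + a * (C - 1) * (numClusters a n C - 1) ≤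
      a * n := by
  set L := a * C * (C - 1) with hL
  have hLn : L ≤ a * n := by
    rw [hL, mul_assoc]
    exact Nat.mul_le_mul_left _ hn
  have h1 : L + (a * n) % L ≤ a * n := by
    rcases Nat.eq_zero_or_pos L with h0 | h0
    · simp [h0]
    · have h2 := Nat.div_add_mod (a * n) L
      have h3 : L * 1 ≤ L * (a * n / L) := Nat.mul_le_mul_left _ (Nat.div_pos hLn h0)
      omega
  have h4 : a * (C - 1) * (numClusters a n C - 1) ≤ a * n - (L + (a * n) % L) := by
    rw [numClusters, Nat.add_sub_cancel]
    exact Nat.mul_div_le _ _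
  omega

theorem numClusters_mul_le {a n C : ℕ} (hC : 2 ≤ C) (hn : C * (C - 1) ≤ n) :
    numClusters a n C * (a * (C - 1)) ≤ a * n := by
  have h := first_add_mul_numClusters_le (a := a) hn
  have h1 : numClusters a n C = (numClusters a n C - 1) + 1 := by
    rw [numClusters, Nat.add_sub_cancel]
  have h2 : a * (C - 1) ≤ a * C * (C - 1) :=
    Nat.mul_le_mul_right _ (Nat.le_mul_of_pos_right a (by omega))
  rw [h1, Nat.add_mul, one_mul, mul_comm (numClusters a n C - 1)]
  omega

theorem lt_mul_numClusters_add {a n C : ℕ} (ha : 0 < a) (hC : 2 ≤ C) :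
    n < C * (numClusters a n C + 2 * C) := by
  have hw : 0 < a * (C - 1) := Nat.mul_pos ha (by omega)
  set L := a * C * (C - 1) with hL
  have hL0 : 0 < L := Nat.mul_pos (Nat.mul_pos ha (by omega)) (by omega)
  have h1 : a * n - (L + (a * n) % L) < a * (C - 1) * numClusters a n C :=
    Nat.lt_mul_div_succ _ hw
  have h2 := Nat.mod_lt (a * n) hL0
  have h3 : a * n < a * ((C - 1) * (numClusters a n C + 2 * C)) := by
    have h4 : a * ((C - 1) * (numClusters a n C + 2 * C)) =
        a * (C - 1) * numClusters a n C + 2 * L := by rw [hL]; ring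
    omega
  exact (Nat.lt_of_mul_lt_mul_left h3).trans_le (Nat.mul_le_mul_right _ (by omega))

open Classical in
theorem one_sub_le_permProb {N M : ℕ} {E : Equiv.Perm (Fin N) × Equiv.Perm (Fin M) → Prop} {ε : ℝ}
    (h : ∀ π₂, ((Finset.univ.filter fun π₁ => ¬ E (π₁, π₂)).card : ℝ) ≤ ε * N.factorial) :
    1 - ε ≤ permProb N M E := by
  have hN : (0 : ℝ) < N.factorial := by exact_mod_cast N.factorial_pos
  have hM : (0 : ℝ) < M.factorial := by exact_mod_cast M.factorial_pos
  have htot : ((Finset.univ : Finset (Equiv.Perm (Fin N) × Equiv.Perm (Fin M))).card : ℝ) =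
      N.factorial * M.factorial := by
    simp [Finset.card_univ, Fintype.card_perm]
  have hsplit := Finset.card_filter_add_card_filter_not
    (s := (Finset.univ : Finset (Equiv.Perm (Fin N) × Equiv.Perm (Fin M)))) E
  have hsplitR : ((Finset.univ.filter E).card : ℝ) + (Finset.univ.filter fun π => ¬ E π).card =
      N.factorial * M.factorial := by
    rw [← htot]
    exact_mod_cast hsplit
  have hbad : ((Finset.univ.filter fun π => ¬ E π).card : ℝ) ≤
      ε * N.factorial * M.factorial := by
    have h1 : (Finset.univ.filter fun π => ¬ E π).card =
        ∑ π₂, (Finset.univ.filter fun π₁ => ¬ E (π₁, π₂)).card := by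
      simp_rw [Finset.card_filter]
      rw [Fintype.sum_prod_type, Finset.sum_comm]
    rw [h1, Nat.cast_sum]
    refine (Finset.sum_le_sum fun π₂ _ => h π₂).trans (le_of_eq ?_)
    rw [Finset.sum_const, Finset.card_univ, Fintype.card_perm, Fintype.card_fin, nsmul_eq_mul]
    ring
  rw [permProb, htot, le_div_iff₀ (by positivity)]
  linarith

theorem not_subSystemMinDeg_iff {k s t n d : ℕ} {δ α : ℝ}
    {Hs : Fin (t * n) → Finset (Finset (Fin (s * n)))} {A : Finset (Fin (s * n))}
    {J : Finset (Fin (t * n))} :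
    ¬ SubSystemMinDeg k s t n d δ α Hs A J (A.card - d) ↔
      HasLowDegree k d (δ + α / 2) Hs J A := by
  simp only [SubSystemMinDeg, HasLowDegree]
  push Not
  rfl

open Classical in
/-- For any colour sets `J i`, the number of permutations with at least `h` low-degree clusters
is exponentially small in `h`. -/
theorem card_perm_many_bad_clusters_le {s n C h M k d : ℕ} {ψ : ℝ} (hs : 0 < s) (hC : 2 ≤ C)
    (hn : C * (C - 1) ≤ n) (hsC : 2 * s ≤ C) (hlow : C ^ 2 * h ≤ numClusters s n C)
    (hhigh : numClusters s n C ≤ 2 * C ^ 2 * h)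
    {Hs : Fin M → Finset (Finset (Fin (s * n)))} {S : Finset (Fin (s * n))} {J : ℕ → Finset (Fin M)}
    (hbad : ∀ i, 2 ≤ i → ((Finset.univ.filter fun x : Fin (s * (C - 1)) → Fin (s * n) =>
      Function.Injective x ∧
        HasLowDegree k d ψ Hs (J i) (Finset.univ.image x ∪ S)).card : ℝ) ≤
        1 / (24 * (C : ℝ) ^ 2) * ((s * n : ℕ) : ℝ) ^ (s * (C - 1))) :
    ((Finset.univ.filter fun π : Equiv.Perm (Fin (s * n)) =>
      h ≤ ((Finset.Icc 2 (numClusters s n C)).filter fun i =>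
        HasLowDegree k d ψ Hs (J i) (partCluster s n C i π ∪ S)).card).card : ℝ) ≤
      (s * n).factorial * (1 / 2) ^ h := by
  set L := Finset.Icc 2 (numClusters s n C) with hL
  have hw : 0 < s * (C - 1) := Nat.mul_pos hs (by omega)
  have hCR : (0 : ℝ) < C := by exact_mod_cast (by omega : 0 < C)
  have hfirst := first_add_mul_numClusters_le (a := s) hn
  set r := s * C * (C - 1) + (s * n) % (s * C * (C - 1)) with hr
  have hI : ∀ I ⊆ L, I.card = h → ((Finset.univ.filter fun π : Equiv.Perm (Fin (s * n)) =>
      ∀ i ∈ I, HasLowDegree k d ψ Hs (J i) (partCluster s n C i π ∪ S)).card : ℝ) ≤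
      (s * n).factorial * (2 * (1 / (24 * (C : ℝ) ^ 2))) ^ h := by
    intro I hIL hIh
    have hi2 : ∀ i : {i // i ∈ I}, 2 ≤ i.1 := fun i => (Finset.mem_Icc.1 (hIL i.2)).1
    have hlt : ∀ q : {i // i ∈ I} × Fin (s * (C - 1)),
        r + s * (C - 1) * (q.1.1 - 2) + q.2.1 < s * n := by
      intro q
      have h1 := Finset.mem_Icc.1 (hIL q.1.2)
      have h2 := q.2.2
      have h3 : s * (C - 1) * (q.1.1 - 2) + s * (C - 1) ≤
          s * (C - 1) * (numClusters s n C - 1) := by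
        rw [← Nat.mul_succ]
        exact Nat.mul_le_mul_left _ (by omega)
      omega
    let pos : {i // i ∈ I} × Fin (s * (C - 1)) → Fin (s * n) := fun q =>
      ⟨r + s * (C - 1) * (q.1.1 - 2) + q.2.1, hlt q⟩
    have hpos : Function.Injective pos := by
      rintro ⟨i, b⟩ ⟨i', b'⟩ hq
      have h1 : r + s * (C - 1) * (i.1 - 2) + b.1 = r + s * (C - 1) * (i'.1 - 2) + b'.1 :=
        congrArg Fin.val hq
      have h2 : i.1 = i'.1 := by
        rw [← clusterIndex_add (r := r) (hi2 i) b.2, h1, clusterIndex_add (hi2 i') b'.2]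
      rw [h2] at h1
      exact Prod.ext (Subtype.ext h2) (Fin.ext (by simpa using h1))
    have hN : 2 * (Fintype.card {i // i ∈ I} * (s * (C - 1)) * (s * (C - 1))) ≤ s * n := by
      rw [Fintype.card_coe, hIh]
      refine le_trans ?_ (numClusters_mul_le hC hn)
      calc 2 * (h * (s * (C - 1)) * (s * (C - 1)))
          = (2 * s) * (C - 1) * h * (s * (C - 1)) := by ring
        _ ≤ C * C * h * (s * (C - 1)) := by gcongr; omega
        _ = C ^ 2 * h * (s * (C - 1)) := by ring
        _ ≤ _ := Nat.mul_le_mul_right _ hlow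
    have hmain := card_perm_forall_blocks_le hpos
      (fun i x => Function.Injective x ∧ HasLowDegree k d ψ Hs (J i.1) (Finset.univ.image x ∪ S))
      (p := 1 / (24 * (C : ℝ) ^ 2)) (by positivity) hN (fun i => by convert hbad i.1 (hi2 i))
    rw [Fintype.card_coe, hIh] at hmain
    refine le_trans (Nat.cast_le.2 (Finset.card_le_card ?_)) hmain
    intro π hπ
    rw [Finset.mem_filter] at hπ
    refine (@Finset.mem_filter _ _ (_) _ _).2 ⟨Finset.mem_univ _, fun i => ⟨?_, ?_⟩⟩
    · intro b b' hb
      exact (Prod.ext_iff.1 (hpos (π.symm.injective hb))).2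
    · rw [← partCluster_eq_image hw (hi2 i) π (pos := fun b => pos (i, b)) (fun _ => rfl)]
      exact hπ.2 i.1 i.2
  have hcount := card_le_card_filter_le L
    (fun i (π : Equiv.Perm (Fin (s * n))) =>
      HasLowDegree k d ψ Hs (J i) (partCluster s n C i π ∪ S)) hI
  refine hcount.trans ?_
  have hLc : (L.card : ℝ) ≤ (2 * (C : ℝ) ^ 2) * h := by
    have : L.card ≤ 2 * C ^ 2 * h := by
      rw [hL, Nat.card_Icc]
      omega
    exact_mod_cast this
  calc (L.card.choose h : ℝ) * ((s * n).factorial * (2 * (1 / (24 * (C : ℝ) ^ 2))) ^ h)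
      ≤ (3 * (2 * (C : ℝ) ^ 2)) ^ h *
        ((s * n).factorial * (2 * (1 / (24 * (C : ℝ) ^ 2))) ^ h) := by
        gcongr
        exact choose_le_three_mul_div_pow hLc
    _ = (s * n).factorial * (3 * (2 * (C : ℝ) ^ 2) * (2 * (1 / (24 * (C : ℝ) ^ 2)))) ^ h := by
        rw [mul_pow (3 * (2 * (C : ℝ) ^ 2))]
        ring
    _ = _ := by
        congr 2
        field_simp
        norm_num

theorem affine_pow_mul_affine_pow_le {s t n K h : ℕ} (hh : 1 ≤ h) (hn : n ≤ K * h) :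
    (((s * n + 1) ^ s * (t * n + 1) ^ t : ℕ) : ℝ) ≤
      ((s * K + 1) ^ s * (t * K + 1) ^ t : ℕ) * (h : ℝ) ^ (s + t) := by
  have h1 : ∀ a, a * n + 1 ≤ (a * K + 1) * h := by
    intro a
    have := Nat.mul_le_mul_left a hn
    nlinarith
  have h2 : (s * n + 1) ^ s * (t * n + 1) ^ t ≤
      (s * K + 1) ^ s * (t * K + 1) ^ t * h ^ (s + t) := by
    calc (s * n + 1) ^ s * (t * n + 1) ^ t
        ≤ ((s * K + 1) * h) ^ s * ((t * K + 1) * h) ^ t :=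
          Nat.mul_le_mul (Nat.pow_le_pow_left (h1 s) s) (Nat.pow_le_pow_left (h1 t) t)
      _ = _ := by rw [mul_pow, mul_pow, pow_add]; ring
  exact_mod_cast h2

open Classical in
theorem every_pair_has_many_assignable_clusters
    (α : ℝ) (hα : 0 < α) (k s t : ℕ) (hk : 0 < k) (hs : 0 < s) (ht : 0 < t) :
    ∃ C₀ : ℕ, ∀ C : ℕ, C₀ ≤ C →
    ∃ n₀ : ℕ, ∀ n : ℕ, n₀ ≤ n →
    ∀ δ : ℝ, 0 ≤ δ → δ ≤ 1 →
    ∀ d : ℕ, 1 ≤ d → d ≤ k - 1 →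
    ∀ Hs : Fin (t * n) → Finset (Finset (Fin (s * n))),
      (∀ i, ∀ e ∈ Hs i, e.card = k) →
      (∀ i (D : Finset (Fin (s * n))), D.card = d →
        (δ + α) * ((s * n - d).choose (k - d) : ℝ) ≤
          (((Hs i).filter fun e => D ⊆ e).card : ℝ)) →
      (99 : ℝ) / 100 ≤
        permProb (s * n) (t * n) (fun π =>
          ∀ S : Finset (Fin (s * n)), S.card ≤ s →
          ∀ T : Finset (Fin (t * n)), T.card ≤ t →
            (1 - 1 / (C : ℝ) ^ 2) * (numClusters s n C : ℝ) ≤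
              (((Finset.Icc 2 (numClusters s n C)).filter fun i =>
                SubSystemMinDeg k s t n d δ α Hs
                  (partCluster s n C i π.1 ∪ S) (partCluster t n C i π.2 ∪ T)
                  ((partCluster s n C i π.1 ∪ S).card - d)).card : ℝ)) := by
  obtain ⟨C₁, N₁, hcluster⟩ := exists_forall_card_hasLowDegree_tuples_le hα t hk hs
  refine ⟨C₁ + 2 * s + 2, fun C hC => ?_⟩
  set K := 2 * C ^ 3 + 2 * C ^ 2 with hK
  obtain ⟨h₀, hh₀⟩ := exists_forall_mul_pow_mul_pow_le
    (((s * K + 1) ^ s * (t * K + 1) ^ t : ℕ) : ℝ) (s + t) (ρ := 1 / 2) (ε := 1 / 100)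
    (by norm_num) (by norm_num) (by norm_num)
  refine ⟨N₁ + K * (h₀ + 1), fun n hn δ hδ0 hδ1 d _ hd Hs hH hdeg => ?_⟩
  have hC2 : 2 ≤ C := by omega
  have hwt : 0 < t * (C - 1) := Nat.mul_pos ht (by omega)
  have hKn : K * (h₀ + 1) ≤ n := by omega
  have hKn' : K ≤ n := (Nat.le_mul_of_pos_right K (by omega)).trans hKn
  have hCC : C * (C - 1) ≤ n := by
    refine le_trans ?_ hKn'
    have : C * (C - 1) ≤ C * C := Nat.mul_le_mul_left _ (by omega)
    nlinarith
  have hlt := lt_mul_numClusters_add (n := n) hs hC2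
  set m := numClusters s n C with hm
  have hm2 : 2 * C ^ 2 ≤ m := by
    by_contra! hcon
    have : C * (m + 2 * C) ≤ C * (2 * C ^ 2 + 2 * C) := Nat.mul_le_mul_left _ (by omega)
    nlinarith
  set h := m / (2 * C ^ 2) + 1 with hh
  have hhigh : m ≤ 2 * C ^ 2 * h := (Nat.lt_mul_div_succ m (by positivity)).le
  have hlow : C ^ 2 * h ≤ m := by
    have h1 := Nat.mul_div_le m (2 * C ^ 2)
    rw [hh, Nat.mul_succ]
    nlinarith
  have hnK : n ≤ K * h := by
    have h1 : C * (m + 2 * C) ≤ C * (2 * C ^ 2 * h + 2 * C * h) :=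
      Nat.mul_le_mul_left _ (Nat.add_le_add hhigh (Nat.le_mul_of_pos_right _ (Nat.succ_pos _)))
    refine hlt.le.trans (h1.trans (le_of_eq ?_))
    rw [hK]
    ring
  have hh₀' : h₀ ≤ h := by
    have := Nat.le_of_mul_le_mul_left (hKn.trans hnK) (by positivity)
    omega
  have hsmall := hh₀ h hh₀'
  rw [show (99 : ℝ) / 100 = 1 - 1 / 100 by norm_num]
  refine one_sub_le_permProb fun π₂ => ?_
  dsimp only
  let sS := Finset.univ.filter fun S : Finset (Fin (s * n)) => S.card ≤ s
  let sT := Finset.univ.filter fun T : Finset (Fin (t * n)) => T.card ≤ t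
  let B : Finset (Fin (s * n)) × Finset (Fin (t * n)) → Finset (Equiv.Perm (Fin (s * n))) :=
    fun q => Finset.univ.filter fun π => h ≤ ((Finset.Icc 2 m).filter fun i =>
      HasLowDegree k d (δ + α / 2) Hs (partCluster t n C i π₂ ∪ q.2)
        (partCluster s n C i π ∪ q.1)).card
  have hsub : (Finset.univ.filter fun π₁ : Equiv.Perm (Fin (s * n)) =>
      ¬ ∀ S : Finset (Fin (s * n)), S.card ≤ s → ∀ T : Finset (Fin (t * n)), T.card ≤ t →
        (1 - 1 / (C : ℝ) ^ 2) * (m : ℝ) ≤ (((Finset.Icc 2 m).filter fun i =>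
          SubSystemMinDeg k s t n d δ α Hs (partCluster s n C i π₁ ∪ S)
            (partCluster t n C i π₂ ∪ T) ((partCluster s n C i π₁ ∪ S).card - d)).card : ℝ)) ⊆
      (sS ×ˢ sT).biUnion B := by
    intro π hπ
    have hπ' := (Finset.mem_filter.1 hπ).2
    push Not at hπ'
    obtain ⟨S, hS, T, hT, hgood⟩ := hπ'
    rw [Finset.mem_biUnion]
    refine ⟨(S, T), by simp [sS, sT, hS, hT], ?_⟩
    simp only [B, Finset.mem_filter, Finset.mem_univ, true_and]
    have hsplit := Finset.card_filter_add_card_filter_not (s := Finset.Icc 2 m) fun i =>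
      SubSystemMinDeg k s t n d δ α Hs (partCluster s n C i π ∪ S)
        (partCluster t n C i π₂ ∪ T) ((partCluster s n C i π ∪ S).card - d)
    simp only [not_subSystemMinDeg_iff, Nat.card_Icc] at hsplit
    have hsplit' : ((Finset.Icc 2 m).filter fun i =>
        SubSystemMinDeg k s t n d δ α Hs (partCluster s n C i π ∪ S)
          (partCluster t n C i π₂ ∪ T) ((partCluster s n C i π ∪ S).card - d)).card +
        ((Finset.Icc 2 m).filter fun i => HasLowDegree k d (δ + α / 2) Hs
          (partCluster t n C i π₂ ∪ T) (partCluster s n C i π ∪ S)).card + 1 = m := by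
      have : 0 < C ^ 2 := by positivity
      omega
    have hsplitR := congrArg (Nat.cast (R := ℝ)) hsplit'
    push_cast at hsplitR
    have hCpos : (0 : ℝ) < (C : ℝ) ^ 2 := by positivity
    have hlowR : (h : ℝ) ≤ 1 / (C : ℝ) ^ 2 * m := by
      rw [one_div_mul_eq_div, le_div_iff₀ hCpos, mul_comm]
      exact_mod_cast hlow
    refine Nat.lt_succ_iff.1 ?_
    have hfin : (h : ℝ) < (((Finset.Icc 2 m).filter fun i => HasLowDegree k d (δ + α / 2) Hs
        (partCluster t n C i π₂ ∪ T) (partCluster s n C i π ∪ S)).card : ℝ) + 1 := by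
      linarith
    exact_mod_cast hfin
  have hB : ∀ q ∈ sS ×ˢ sT, ((B q).card : ℝ) ≤ (s * n).factorial * (1 / 2) ^ h := by
    rintro ⟨S, T⟩ hq
    simp only [Finset.mem_product, sS, sT, Finset.mem_filter, Finset.mem_univ, true_and] at hq
    refine card_perm_many_bad_clusters_le hs hC2 hCC (by omega) hlow hhigh fun i hi => ?_
    refine hcluster C (by omega) (s * n) ?_ δ hδ0 hδ1 d hd _ Hs hH hdeg _ S ?_ hq.1
    · have : n ≤ s * n := Nat.le_mul_of_pos_left n hs
      omega
    · refine (Finset.card_union_le _ _).trans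
        ((Nat.add_le_add (card_partCluster_le hwt hi π₂) hq.2).trans (le_of_eq ?_))
      rw [← Nat.mul_succ]
      congr 1
      omega
  have hcard : (sS ×ˢ sT).card ≤ (s * n + 1) ^ s * (t * n + 1) ^ t := by
    rw [Finset.card_product]
    refine Nat.mul_le_mul ?_ ?_
    · simpa using card_filter_card_le (α := Fin (s * n)) s
    · simpa using card_filter_card_le (α := Fin (t * n)) t
  calc _ ≤ (((sS ×ˢ sT).biUnion B).card : ℝ) := by
        refine Nat.cast_le.2 (Finset.card_le_card ?_)
        convert hsub
    _ ≤ ((∑ q ∈ sS ×ˢ sT, (B q).card : ℕ) : ℝ) := Nat.cast_le.2 Finset.card_biUnion_le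
    _ = ∑ q ∈ sS ×ˢ sT, ((B q).card : ℝ) := by push_cast; rfl
    _ ≤ (sS ×ˢ sT).card * ((s * n).factorial * (1 / 2) ^ h) := by
        refine (Finset.sum_le_sum hB).trans (le_of_eq ?_)
        rw [Finset.sum_const, nsmul_eq_mul]
    _ ≤ ((s * K + 1) ^ s * (t * K + 1) ^ t : ℕ) * (h : ℝ) ^ (s + t) *
        ((s * n).factorial * (1 / 2) ^ h) := by
        refine mul_le_mul_of_nonneg_right ?_ (by positivity)
        exact (Nat.cast_le.2 hcard).trans (affine_pow_mul_affine_pow_le (Nat.succ_pos _) hnK)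
    _ = ((s * K + 1) ^ s * (t * K + 1) ^ t : ℕ) * ((h : ℝ) ^ (s + t) * (1 / 2) ^ h) *
        (s * n).factorial := by ring
    _ ≤ 1 / 100 * (s * n).factorial := by gcongr
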